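/- Let (A^{•,•}, ∂, ∂̄) be a bounded double complex of finite-dimensional vector spaces over a field K. Then for every k ∈ ℤ one has Σ_{p+q=k} (dim_K H_BC^{p,q} + dim_K H_A^{p,q}) ≥ 2·b_k. (This is the algebraic, double-complex form of the Frölicher-type inequality of Angella–Tomassini, whose application to the double complex of (p,q)-forms gives the inequality for compact complex manifolds.) -/

import Mathlib

open LinearMap Submodule Module DirectSum

namespace Paper

section DoubleComplex

variable (K : Type) [Field K]
variable (A : ℤ → ℤ → Type) [∀ p q, AddCommGroup (A p q)] [∀ p q, Module K (A p q)]

/-- Transport along equalities of the indices. -/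
def dcCast {p q p' q' : ℤ} (h1 : p = p') (h2 : q = q') : A p q ≃ₗ[K] A p' q' := by
  subst h1; subst h2; exact LinearEquiv.refl K (A p q)

variable (d1 : ∀ p q : ℤ, A p q →ₗ[K] A (p + 1) q)
variable (d2 : ∀ p q : ℤ, A p q →ₗ[K] A p (q + 1))

/-- The operator ∂∂̄ : A^{p,q} → A^{p+1,q+1} (apply ∂̄ first, then ∂). -/
def ddBar (p q : ℤ) : A p q →ₗ[K] A (p + 1) (q + 1) := (d1 p (q + 1)).comp (d2 p q)

/-- The image ∂∂̄(A^{p-1,q-1}) inside A^{p,q}. -/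
def ddBarIm (p q : ℤ) : Submodule K (A p q) :=
  range ((dcCast K A (show p - 1 + 1 = p by ring) (show q - 1 + 1 = q by ring)).toLinearMap.comp
    (ddBar K A d1 d2 (p - 1) (q - 1)))

/-- Bott-Chern cohomology H_BC^{p,q} = (ker ∂ ∩ ker ∂̄)/∂∂̄(A^{p-1,q-1}). -/
abbrev HBC (p q : ℤ) :=
  ↥(ker (d1 p q) ⊓ ker (d2 p q)) ⧸
    ((ddBarIm K A d1 d2 p q).comap (ker (d1 p q) ⊓ ker (d2 p q)).subtype)

noncomputable def hBC (p q : ℤ) : ℕ := finrank K (HBC K A d1 d2 p q)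

/-- ∂(A^{p-1,q}) + ∂̄(A^{p,q-1}) inside A^{p,q}. -/
def aDen (p q : ℤ) : Submodule K (A p q) :=
  range ((dcCast K A (show p - 1 + 1 = p by ring) rfl).toLinearMap.comp (d1 (p - 1) q)) ⊔
  range ((dcCast K A rfl (show q - 1 + 1 = q by ring)).toLinearMap.comp (d2 p (q - 1)))

/-- Aeppli cohomology H_A^{p,q} = ker ∂∂̄ / (im ∂ + im ∂̄). -/
abbrev HA (p q : ℤ) :=
  ↥(ker (ddBar K A d1 d2 p q)) ⧸ ((aDen K A d1 d2 p q).comap (ker (ddBar K A d1 d2 p q)).subtype)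

noncomputable def hA (p q : ℤ) : ℕ := finrank K (HA K A d1 d2 p q)

/-- Column (Dolbeault) cohomology H_∂̄^{p,q}. -/
abbrev HDolb (p q : ℤ) :=
  ↥(ker (d2 p q)) ⧸
    ((range ((dcCast K A rfl (show q - 1 + 1 = q by ring)).toLinearMap.comp (d2 p (q - 1)))).comap
      (ker (d2 p q)).subtype)

noncomputable def hDolb (p q : ℤ) : ℕ := finrank K (HDolb K A d2 p q)

/-- Row cohomology H_∂^{p,q}. -/
abbrev HRow (p q : ℤ) :=
  ↥(ker (d1 p q)) ⧸
    ((range ((dcCast K A (show p - 1 + 1 = p by ring) rfl).toLinearMap.comp (d1 (p - 1) q))).comap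
      (ker (d1 p q)).subtype)

noncomputable def hRow (p q : ℤ) : ℕ := finrank K (HRow K A d1 p q)

/-- Total complex Tot^k = ⊕_{p+q=k} A^{p,q}. -/
abbrev Tot (k : ℤ) := ⨁ p : ℤ, A p (k - p)

/-- Total differential d = ∂ + ∂̄ on the total complex. -/
noncomputable def totD (k : ℤ) : Tot A k →ₗ[K] Tot A (k + 1) :=
  DirectSum.toModule K ℤ (Tot A (k + 1)) fun p =>
    ((DirectSum.lof K ℤ (fun p' => A p' (k + 1 - p')) (p + 1)).comp
      ((dcCast K A rfl (show k - p = k + 1 - (p + 1) by ring)).toLinearMap.comp (d1 p (k - p))))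
    +
    ((DirectSum.lof K ℤ (fun p' => A p' (k + 1 - p')) p).comp
      ((dcCast K A rfl (show k - p + 1 = k + 1 - p by ring)).toLinearMap.comp (d2 p (k - p))))

def totCast {k k' : ℤ} (h : k = k') : Tot A k ≃ₗ[K] Tot A k' := by
  subst h; exact LinearEquiv.refl K (Tot A k)

/-- b_k = dim H^k(Tot, d). -/
noncomputable def bNum (k : ℤ) : ℕ :=
  finrank K
    (↥(ker (totD K A d1 d2 k)) ⧸
      ((range ((totCast K A (show k - 1 + 1 = k by ring)).toLinearMap.comp
        (totD K A d1 d2 (k - 1)))).comap (ker (totD K A d1 d2 k)).subtype))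

/-- The ∂∂̄-lemma: ker ∂ ∩ ker ∂̄ ∩ (im ∂ + im ∂̄) ⊆ im ∂∂̄ in each bidegree. -/
def DDbarLemma : Prop :=
  ∀ p q : ℤ, (ker (d1 p q) ⊓ ker (d2 p q)) ⊓ aDen K A d1 d2 p q ≤ ddBarIm K A d1 d2 p q

end DoubleComplex

/-- The map between sub-quotients induced by the identity. -/
def qMap (K : Type) [Field K] {V : Type} [AddCommGroup V] [Module K V]
    {N1 N2 M1 M2 : Submodule K V} (hN : N1 ≤ N2) (hM : M1 ≤ M2) :
    (↥N1 ⧸ M1.comap N1.subtype) →ₗ[K] (↥N2 ⧸ M2.comap N2.subtype) :=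
  Submodule.mapQ _ _ (Submodule.inclusion hN) (by
    intro x hx
    simp only [Submodule.mem_comap, Submodule.coe_subtype] at hx ⊢
    simpa using hM hx)

section SComplex

variable (K : Type) [Field K]
variable (A : ℤ → Type) [∀ k, AddCommGroup (A k)] [∀ k, Module K (A k)]

def sCast {k k' : ℤ} (h : k = k') : A k ≃ₗ[K] A k' := by
  subst h; exact LinearEquiv.refl K (A k)

variable (d : ∀ k : ℤ, A k →ₗ[K] A (k + 1))
variable (dl : ∀ k : ℤ, A k →ₗ[K] A (k - 1))

/-- The degree-0 operator dδ : A^k → A^k (apply δ first, then d). -/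
def dDelta (k : ℤ) : A k →ₗ[K] A k :=
  (sCast K A (show k - 1 + 1 = k by ring)).toLinearMap.comp ((d (k - 1)).comp (dl k))

/-- Symplectic-type Bott-Chern cohomology H_BC^k = (ker d ∩ ker δ)/dδ(A^k). -/
abbrev HBCs (k : ℤ) :=
  ↥(ker (d k) ⊓ ker (dl k)) ⧸
    ((range (dDelta K A d dl k)).comap (ker (d k) ⊓ ker (dl k)).subtype)

noncomputable def hBCs (k : ℤ) : ℕ := finrank K (HBCs K A d dl k)

/-- d(A^{k-1}) + δ(A^{k+1}) inside A^k. -/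
def sDen (k : ℤ) : Submodule K (A k) :=
  range ((sCast K A (show k - 1 + 1 = k by ring)).toLinearMap.comp (d (k - 1))) ⊔
  range ((sCast K A (show k + 1 - 1 = k by ring)).toLinearMap.comp (dl (k + 1)))

/-- Symplectic-type Aeppli cohomology H_A^k = ker dδ / (im d + im δ). -/
abbrev HAs (k : ℤ) :=
  ↥(ker (dDelta K A d dl k)) ⧸ ((sDen K A d dl k).comap (ker (dDelta K A d dl k)).subtype)

noncomputable def hAs (k : ℤ) : ℕ := finrank K (HAs K A d dl k)

/-- H_d^k = ker d / im d. -/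
abbrev Hds (k : ℤ) :=
  ↥(ker (d k)) ⧸
    ((range ((sCast K A (show k - 1 + 1 = k by ring)).toLinearMap.comp (d (k - 1)))).comap
      (ker (d k)).subtype)

noncomputable def hds (k : ℤ) : ℕ := finrank K (Hds K A d k)

/-- H_δ^k = ker δ / im δ. -/
abbrev Hdls (k : ℤ) :=
  ↥(ker (dl k)) ⧸
    ((range ((sCast K A (show k + 1 - 1 = k by ring)).toLinearMap.comp (dl (k + 1)))).comap
      (ker (dl k)).subtype)

noncomputable def hdls (k : ℤ) : ℕ := finrank K (Hdls K A dl k)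

/-- The dδ-lemma: ker d ∩ ker δ ∩ (im d + im δ) ⊆ im dδ in each degree. -/
def DDeltaLemma : Prop :=
  ∀ k : ℤ, (ker (d k) ⊓ ker (dl k)) ⊓ sDen K A d dl k ≤ range (dDelta K A d dl k)

/-- The strip double complex B^{p,q} = A^{p-q}. -/
abbrev strip (p q : ℤ) := A (p - q)

/-- ∂ on the strip double complex, given by d. -/
def stripD1 (p q : ℤ) : strip A p q →ₗ[K] strip A (p + 1) q :=
  (sCast K A (show p - q + 1 = p + 1 - q by ring)).toLinearMap.comp (d (p - q))

/-- ∂̄ on the strip double complex, given by δ. -/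
def stripD2 (p q : ℤ) : strip A p q →ₗ[K] strip A p (q + 1) :=
  (sCast K A (show p - q - 1 = p - (q + 1) by ring)).toLinearMap.comp (dl (p - q))

end SComplex

section Helpers

lemma finrank_subquotient_add {K V : Type*} [Field K] [AddCommGroup V] [Module K V]
    [FiniteDimensional K V] {M N : Submodule K V} (h : M ≤ N) :
    finrank K (↥N ⧸ M.comap N.subtype) + finrank K M = finrank K N := by
  rw [← (Submodule.comapSubtypeEquivOfLe h).finrank_eq]
  exact Submodule.finrank_quotient_add_finrank _

lemma finrank_range_equiv_comp {K V W W' : Type*} [Field K] [AddCommGroup V] [Module K V]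
    [AddCommGroup W] [Module K W] [AddCommGroup W'] [Module K W'] (e : W ≃ₗ[K] W')
    (f : V →ₗ[K] W) : finrank K (range (e.toLinearMap.comp f)) = finrank K (range f) := by
  rw [LinearMap.range_comp]
  exact LinearEquiv.finrank_map_eq e (range f)

section FamilyDirectSum

variable {K ι : Type*} [Field K] {B : ι → Type*} [∀ i, AddCommGroup (B i)] [∀ i, Module K (B i)]

lemma directSum_equiv_pi_of_subsingleton (T : Finset ι) (hT : ∀ i ∉ T, Subsingleton (B i)) :
    Nonempty ((⨁ i, B i) ≃ₗ[K] (∀ i : T, B i)) := by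
  classical
  let φ : (⨁ i, B i) →ₗ[K] (∀ i : T, B i) :=
    LinearMap.pi fun i => DirectSum.component K ι B i
  refine ⟨LinearEquiv.ofBijective φ ⟨?_, ?_⟩⟩
  · intro x y hxy
    refine DFinsupp.ext fun i => ?_
    by_cases hi : i ∈ T
    · exact congrFun hxy ⟨i, hi⟩
    · have := hT i hi
      exact Subsingleton.elim _ _
  · intro y
    refine ⟨DFinsupp.mk T y, ?_⟩
    funext i
    exact DFinsupp.mk_of_mem i.2

variable [∀ i, FiniteDimensional K (B i)]

lemma finiteDimensional_directSum (T : Finset ι) (hT : ∀ i ∉ T, Subsingleton (B i)) :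
    FiniteDimensional K (⨁ i, B i) := by
  obtain ⟨e⟩ := directSum_equiv_pi_of_subsingleton (K := K) T hT
  exact Module.Finite.equiv e.symm

lemma finrank_directSum_of_subsingleton (T : Finset ι) (hT : ∀ i ∉ T, Subsingleton (B i)) :
    finrank K (⨁ i, B i) = ∑ i ∈ T, finrank K (B i) := by
  obtain ⟨e⟩ := directSum_equiv_pi_of_subsingleton (K := K) T hT
  rw [e.finrank_eq, Module.finrank_pi_fintype]
  exact Finset.sum_coe_sort T fun i => finrank K (B i)

/-- A linear map that is injective on a direct sum of complements of the kernels of `g i`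
has rank at least the sum of the ranks of the `g i`. -/
lemma sum_finrank_range_le {W : Type*} [AddCommGroup W] [Module K W]
    (T : Finset ι) (hT : ∀ i ∉ T, Subsingleton (B i))
    {C : ι → Type*} [∀ i, AddCommGroup (C i)] [∀ i, Module K (C i)]
    (g : ∀ i, B i →ₗ[K] C i) (D : (⨁ i, B i) →ₗ[K] W)
    (hD : ∀ U : ∀ i, Submodule K (B i), (∀ i, Disjoint (ker (g i)) (U i)) →
      ∀ x : ⨁ i, B i, (∀ i, x i ∈ U i) → D x = 0 → x = 0) :
    ∑ i ∈ T, finrank K (range (g i)) ≤ finrank K (range D) := by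
  choose U hU using fun i => Submodule.exists_isCompl (ker (g i))
  have hTU : ∀ i ∉ T, Subsingleton (U i) := fun i hi => by
    have := hT i hi
    infer_instance
  have hfin := finiteDimensional_directSum (K := K) T hT
  let ψ : (⨁ i, U i) →ₗ[K] (⨁ i, B i) := DFinsupp.mapRange.linearMap fun i => (U i).subtype
  have hψ : ∀ x i, ψ x i = (x i : B i) := fun x i => rfl
  have hinj : Function.Injective (D.rangeRestrict.comp ψ) := by
    rw [← LinearMap.ker_eq_bot, LinearMap.ker_eq_bot']
    intro x hx
    have h0 : D (ψ x) = 0 := congrArg Subtype.val hx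
    have h1 := hD U (fun i => (hU i).disjoint) (ψ x) (fun i => by rw [hψ]; exact (x i).2) h0
    refine DFinsupp.ext fun i => Subtype.ext ?_
    rw [← hψ, h1]
    rfl
  have hle := LinearMap.finrank_le_finrank_of_injective hinj
  rw [finrank_directSum_of_subsingleton T hTU] at hle
  refine le_trans (Finset.sum_le_sum fun i _ => le_of_eq ?_) hle
  have h1 := (g i).finrank_range_add_finrank_ker
  have h2 := Submodule.finrank_add_eq_of_isCompl (hU i)
  omega

end FamilyDirectSum

variable {K : Type} [Field K]
variable {A : ℤ → ℤ → Type} [∀ p q, AddCommGroup (A p q)] [∀ p q, Module K (A p q)]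

lemma dcCast_dcCast {p q p' q' p'' q'' : ℤ} (h1 : p = p') (h2 : q = q') (h1' : p' = p'')
    (h2' : q' = q'') (x : A p q) :
    dcCast K A h1' h2' (dcCast K A h1 h2 x) = dcCast K A (h1.trans h1') (h2.trans h2') x := by
  subst h1 h2 h1' h2'
  rfl

lemma d1_dcCast (d1 : ∀ p q : ℤ, A p q →ₗ[K] A (p + 1) q) {p q p' q' : ℤ} (h1 : p = p')
    (h2 : q = q') (x : A p q) :
    d1 p' q' (dcCast K A h1 h2 x) = dcCast K A (congrArg (· + 1) h1) h2 (d1 p q x) := by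
  subst h1 h2
  rfl

lemma d2_dcCast (d2 : ∀ p q : ℤ, A p q →ₗ[K] A p (q + 1)) {p q p' q' : ℤ} (h1 : p = p')
    (h2 : q = q') (x : A p q) :
    d2 p' q' (dcCast K A h1 h2 x) = dcCast K A h1 (congrArg (· + 1) h2) (d2 p q x) := by
  subst h1 h2
  rfl

variable (d1 : ∀ p q : ℤ, A p q →ₗ[K] A (p + 1) q)
variable (d2 : ∀ p q : ℤ, A p q →ₗ[K] A p (q + 1))

lemma totD_lof (k p : ℤ) (a : A p (k - p)) :
    totD K A d1 d2 k (DirectSum.lof K ℤ (fun i => A i (k - i)) p a) =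
      DirectSum.lof K ℤ (fun i => A i (k + 1 - i)) (p + 1)
        (dcCast K A rfl (show k - p = k + 1 - (p + 1) by ring) (d1 p (k - p) a)) +
      DirectSum.lof K ℤ (fun i => A i (k + 1 - i)) p
        (dcCast K A rfl (show k - p + 1 = k + 1 - p by ring) (d2 p (k - p) a)) := by
  simp [totD, DirectSum.toModule_lof]

lemma totD_apply_add_one (k p : ℤ) (x : Tot A k) :
    totD K A d1 d2 k x (p + 1) =
      dcCast K A rfl (show k - p = k + 1 - (p + 1) by ring) (d1 p (k - p) (x p)) +
      dcCast K A rfl (show k - (p + 1) + 1 = k + 1 - (p + 1) by ring)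
        (d2 (p + 1) (k - (p + 1)) (x (p + 1))) := by
  induction x using DirectSum.induction_on with
  | zero => simp
  | add x y hx hy =>
    rw [map_add, DirectSum.add_apply, hx, hy]
    simp only [DirectSum.add_apply, map_add]
    abel
  | of j a =>
    change totD K A d1 d2 k (DirectSum.lof K ℤ (fun i => A i (k - i)) j a) (p + 1) = _
    rw [totD_lof, DirectSum.add_apply]
    simp only [DirectSum.lof_eq_of]
    by_cases h : j = p
    · subst h
      rw [DirectSum.of_eq_same, DirectSum.of_eq_same, DirectSum.of_eq_of_ne _ _ _ (by omega),
        DirectSum.of_eq_of_ne _ _ _ (by omega)]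
      simp
    · by_cases h' : j = p + 1
      · subst h'
        rw [DirectSum.of_eq_same, DirectSum.of_eq_same, DirectSum.of_eq_of_ne _ _ _ (by omega),
          DirectSum.of_eq_of_ne _ _ _ (by omega)]
        simp
      · rw [DirectSum.of_eq_of_ne _ _ _ (by omega), DirectSum.of_eq_of_ne _ _ _ (by omega),
          DirectSum.of_eq_of_ne _ _ _ (by omega), DirectSum.of_eq_of_ne _ _ _ (by omega)]
        simp

variable {d1 d2}

lemma totD_totD
    (hd1d1 : ∀ (p q : ℤ) (x : A p q), d1 (p + 1) q (d1 p q x) = 0)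
    (hd2d2 : ∀ (p q : ℤ) (x : A p q), d2 p (q + 1) (d2 p q x) = 0)
    (hanti : ∀ (p q : ℤ) (x : A p q), d1 p (q + 1) (d2 p q x) + d2 (p + 1) q (d1 p q x) = 0)
    (k : ℤ) (x : Tot A k) :
    totD K A d1 d2 (k + 1) (totD K A d1 d2 k x) = 0 := by
  induction x using DirectSum.induction_on with
  | zero => simp
  | add x y hx hy => rw [map_add, map_add, hx, hy, add_zero]
  | of j a =>
    change totD K A d1 d2 (k + 1) (totD K A d1 d2 k
      (DirectSum.lof K ℤ (fun i => A i (k - i)) j a)) = _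
    rw [totD_lof, map_add, totD_lof, totD_lof]
    simp only [d1_dcCast, d2_dcCast, dcCast_dcCast, hd1d1, hd2d2, map_zero, zero_add, add_zero]
    rw [← map_add, ← map_add, (add_comm _ _).trans (hanti j (k - j) a), map_zero, map_zero]

lemma totD_totCast_totD
    (hd1d1 : ∀ (p q : ℤ) (x : A p q), d1 (p + 1) q (d1 p q x) = 0)
    (hd2d2 : ∀ (p q : ℤ) (x : A p q), d2 p (q + 1) (d2 p q x) = 0)
    (hanti : ∀ (p q : ℤ) (x : A p q), d1 p (q + 1) (d2 p q x) + d2 (p + 1) q (d1 p q x) = 0)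
    {m k : ℤ} (h : m + 1 = k) (x : Tot A m) :
    totD K A d1 d2 k (totCast K A h (totD K A d1 d2 m x)) = 0 := by
  subst h
  exact totD_totD hd1d1 hd2d2 hanti m x

variable (d1 d2) in
lemma eq_zero_of_totD_eq_zero_of_disjoint_ker_d2 (k : ℤ)
    (U : ∀ p, Submodule K (A p (k - p))) (hU : ∀ p, Disjoint (ker (d2 p (k - p))) (U p))
    (x : Tot A k) (hx : ∀ p, x p ∈ U p) (h : totD K A d1 d2 k x = 0) : x = 0 := by
  by_contra hne
  obtain ⟨p, hp, hmin⟩ := Set.exists_min_image {i | x i ≠ 0} id (DFinsupp.finite_support x)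
    (by
      by_contra he
      rw [Set.not_nonempty_iff_eq_empty, Set.eq_empty_iff_forall_notMem] at he
      exact hne (DFinsupp.ext fun i => not_not.mp (he i)))
  obtain ⟨r, rfl⟩ : ∃ r, p = r + 1 := ⟨p - 1, by ring⟩
  have hr : x r = 0 := by
    by_contra hr
    have := hmin r hr
    simp at this
  have h1 := totD_apply_add_one d1 d2 k r x
  rw [h, hr, map_zero, map_zero, zero_add] at h1
  exact hp (Submodule.disjoint_def.mp (hU _) _ (LinearEquiv.map_eq_zero_iff _ |>.mp h1.symm) (hx _))

variable (d1 d2) in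
lemma eq_zero_of_totD_eq_zero_of_disjoint_ker_d1 (k : ℤ)
    (U : ∀ p, Submodule K (A p (k - p))) (hU : ∀ p, Disjoint (ker (d1 p (k - p))) (U p))
    (x : Tot A k) (hx : ∀ p, x p ∈ U p) (h : totD K A d1 d2 k x = 0) : x = 0 := by
  by_contra hne
  obtain ⟨p, hp, hmax⟩ := Set.exists_max_image {i | x i ≠ 0} id (DFinsupp.finite_support x)
    (by
      by_contra he
      rw [Set.not_nonempty_iff_eq_empty, Set.eq_empty_iff_forall_notMem] at he
      exact hne (DFinsupp.ext fun i => not_not.mp (he i)))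
  have hr : x (p + 1) = 0 := by
    by_contra hr
    have := hmax (p + 1) hr
    simp at this
  have h1 := totD_apply_add_one d1 d2 k p x
  rw [h, hr, map_zero, map_zero, add_zero] at h1
  exact hp (Submodule.disjoint_def.mp (hU _) _ (LinearEquiv.map_eq_zero_iff _ |>.mp h1.symm) (hx _))

lemma bNum_add_finrank_range
    (hd1d1 : ∀ (p q : ℤ) (x : A p q), d1 (p + 1) q (d1 p q x) = 0)
    (hd2d2 : ∀ (p q : ℤ) (x : A p q), d2 p (q + 1) (d2 p q x) = 0)
    (hanti : ∀ (p q : ℤ) (x : A p q), d1 p (q + 1) (d2 p q x) + d2 (p + 1) q (d1 p q x) = 0)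
    (k : ℤ) [FiniteDimensional K (Tot A k)] :
    bNum K A d1 d2 k + finrank K (range (totD K A d1 d2 (k - 1))) +
      finrank K (range (totD K A d1 d2 k)) = finrank K (Tot A k) := by
  have hle : range ((totCast K A (show k - 1 + 1 = k by ring)).toLinearMap.comp
      (totD K A d1 d2 (k - 1))) ≤ ker (totD K A d1 d2 k) := by
    rintro _ ⟨y, rfl⟩
    exact totD_totCast_totD hd1d1 hd2d2 hanti _ y
  have e1 : bNum K A d1 d2 k + _ = _ := finrank_subquotient_add hle
  rw [finrank_range_equiv_comp] at e1
  have e2 := (totD K A d1 d2 k).finrank_range_add_finrank_ker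
  omega

variable [∀ p q, FiniteDimensional K (A p q)]

/-- The pointwise inequality `h_∂ + h_∂̄ ≤ h_BC + h_A`, with the left side expanded into ranks. -/
lemma two_mul_finrank_le
    (hd1d1 : ∀ (p q : ℤ) (x : A p q), d1 (p + 1) q (d1 p q x) = 0)
    (hd2d2 : ∀ (p q : ℤ) (x : A p q), d2 p (q + 1) (d2 p q x) = 0)
    (hanti : ∀ (p q : ℤ) (x : A p q), d1 p (q + 1) (d2 p q x) + d2 (p + 1) q (d1 p q x) = 0)
    (p q : ℤ) :
    2 * finrank K (A p q) ≤ hBC K A d1 d2 p q + hA K A d1 d2 p q +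
      finrank K (range (d1 p q)) + finrank K (range (d2 p q)) +
      finrank K (range (d1 (p - 1) q)) + finrank K (range (d2 p (q - 1))) := by
  have hanti' : ∀ (p q : ℤ) (x : A p q), d1 p (q + 1) (d2 p q x) = -d2 (p + 1) q (d1 p q x) :=
    fun p q x => eq_neg_of_add_eq_zero_left (hanti p q x)
  have hBCle : ddBarIm K A d1 d2 p q ≤ ker (d1 p q) ⊓ ker (d2 p q) := by
    rintro _ ⟨y, rfl⟩
    simp only [ddBar, Submodule.mem_inf, LinearMap.mem_ker, LinearMap.comp_apply,
      LinearEquiv.coe_coe]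
    refine ⟨?_, ?_⟩
    · rw [d1_dcCast, hd1d1, map_zero]
    · rw [hanti', map_neg, map_neg, d2_dcCast, hd2d2, map_zero, neg_zero]
  have hAle : aDen K A d1 d2 p q ≤ ker (ddBar K A d1 d2 p q) := by
    refine sup_le ?_ ?_
    · rintro _ ⟨y, rfl⟩
      simp only [ddBar, LinearMap.mem_ker, LinearMap.comp_apply, LinearEquiv.coe_coe]
      rw [hanti', d1_dcCast, hd1d1, map_zero, map_zero, neg_zero]
    · rintro _ ⟨y, rfl⟩
      simp only [ddBar, LinearMap.mem_ker, LinearMap.comp_apply, LinearEquiv.coe_coe]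
      rw [d2_dcCast, hd2d2, map_zero, map_zero]
  have hker : ker (d1 p q) ⊔ ker (d2 p q) ≤ ker (ddBar K A d1 d2 p q) := by
    refine sup_le ?_ ?_
    · intro y hy
      rw [LinearMap.mem_ker] at hy ⊢
      rw [ddBar, LinearMap.comp_apply, hanti', hy, map_zero, neg_zero]
    · intro y hy
      rw [LinearMap.mem_ker] at hy ⊢
      rw [ddBar, LinearMap.comp_apply, hy, map_zero]
  have him : ddBarIm K A d1 d2 p q ≤
      range ((dcCast K A (show p - 1 + 1 = p by ring) rfl).toLinearMap.comp (d1 (p - 1) q)) ⊓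
      range ((dcCast K A rfl (show q - 1 + 1 = q by ring)).toLinearMap.comp (d2 p (q - 1))) := by
    rintro _ ⟨y, rfl⟩
    refine ⟨⟨dcCast K A rfl (by ring) (d2 (p - 1) (q - 1) y), ?_⟩,
      ⟨-dcCast K A (by ring) rfl (d1 (p - 1) (q - 1) y), ?_⟩⟩
    · simp only [ddBar, LinearMap.comp_apply, LinearEquiv.coe_coe, d1_dcCast, dcCast_dcCast]
    · simp only [ddBar, LinearMap.comp_apply, LinearEquiv.coe_coe, map_neg, d2_dcCast,
        dcCast_dcCast, hanti']
  have e1 : hBC K A d1 d2 p q + _ = _ := finrank_subquotient_add hBCle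
  have e2 : hA K A d1 d2 p q + _ = _ := finrank_subquotient_add hAle
  have e3 := Submodule.finrank_sup_add_finrank_inf_eq (ker (d1 p q)) (ker (d2 p q))
  have e4 := Submodule.finrank_sup_add_finrank_inf_eq
    (range ((dcCast K A (show p - 1 + 1 = p by ring) rfl).toLinearMap.comp (d1 (p - 1) q)))
    (range ((dcCast K A rfl (show q - 1 + 1 = q by ring)).toLinearMap.comp (d2 p (q - 1))))
  rw [finrank_range_equiv_comp, finrank_range_equiv_comp] at e4
  have e5 := Submodule.finrank_mono hker
  have e6 := Submodule.finrank_mono him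
  have e7 := (d1 p q).finrank_range_add_finrank_ker
  have e8 := (d2 p q).finrank_range_add_finrank_ker
  rw [aDen] at e2
  omega

end Helpers

theorem frolicher_type_inequality_BC_A (K : Type) [Field K]
    (A : ℤ → ℤ → Type) [∀ p q, AddCommGroup (A p q)] [∀ p q, Module K (A p q)]
    [∀ p q, FiniteDimensional K (A p q)]
    (d1 : ∀ p q : ℤ, A p q →ₗ[K] A (p + 1) q)
    (d2 : ∀ p q : ℤ, A p q →ₗ[K] A p (q + 1))
    (hbdd : {pq : ℤ × ℤ | Nontrivial (A pq.1 pq.2)}.Finite)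
    (hd1d1 : ∀ (p q : ℤ) (x : A p q), d1 (p + 1) q (d1 p q x) = 0)
    (hd2d2 : ∀ (p q : ℤ) (x : A p q), d2 p (q + 1) (d2 p q x) = 0)
    (hanti : ∀ (p q : ℤ) (x : A p q), d1 p (q + 1) (d2 p q x) + d2 (p + 1) q (d1 p q x) = 0) :
    ∀ k : ℤ,
      2 * bNum K A d1 d2 k ≤
        ∑ᶠ p : ℤ, (hBC K A d1 d2 p (k - p) + hA K A d1 d2 p (k - p)) := by
  intro k
  obtain ⟨T, hT, hT'⟩ : ∃ T : Finset ℤ, (∀ p ∉ T, ∀ q, Subsingleton (A p q)) ∧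
      ∀ p ∉ T, ∀ q, Subsingleton (A (p - 1) q) := by
    classical
    let S := hbdd.toFinset.image Prod.fst
    have hS : ∀ p ∉ S, ∀ q, Subsingleton (A p q) := by
      intro p hp q
      by_contra hn
      rw [not_subsingleton_iff_nontrivial] at hn
      exact hp (Finset.mem_image.mpr ⟨(p, q), by simpa using hn, rfl⟩)
    refine ⟨S ∪ S.image (· + 1), fun p hp => hS p fun h => hp (Finset.mem_union_left _ h),
      fun p hp => hS _ fun h => hp (Finset.mem_union_right _ ?_)⟩
    exact Finset.mem_image.mpr ⟨p - 1, h, by ring⟩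
  have hsum : ∑ᶠ p : ℤ, (hBC K A d1 d2 p (k - p) + hA K A d1 d2 p (k - p)) =
      ∑ p ∈ T, (hBC K A d1 d2 p (k - p) + hA K A d1 d2 p (k - p)) := by
    refine finsum_eq_sum_of_support_subset _ fun p hp => ?_
    by_contra hpT
    have := hT p hpT (k - p)
    have h1 : hBC K A d1 d2 p (k - p) = 0 := finrank_zero_of_subsingleton
    have h2 : hA K A d1 d2 p (k - p) = 0 := finrank_zero_of_subsingleton
    exact hp (by simp only [h1, h2, add_zero])
  have hfin := finiteDimensional_directSum (K := K) (B := fun p => A p (k - p)) T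
    fun p hp => hT p hp _
  have hdim : finrank K (Tot A k) = _ :=
    finrank_directSum_of_subsingleton T fun p hp => hT p hp _
  have hb := bNum_add_finrank_range hd1d1 hd2d2 hanti k
  have hr1 (m : ℤ) := sum_finrank_range_le T (fun p hp => hT p hp (m - p))
    (fun p => d1 p (m - p)) (totD K A d1 d2 m)
    (eq_zero_of_totD_eq_zero_of_disjoint_ker_d1 d1 d2 m)
  have hr2 (m : ℤ) := sum_finrank_range_le T (fun p hp => hT p hp (m - p))
    (fun p => d2 p (m - p)) (totD K A d1 d2 m)
    (eq_zero_of_totD_eq_zero_of_disjoint_ker_d2 d1 d2 m)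
  have hzero (p q : ℤ) (h : Subsingleton (A p q)) : finrank K (range (d1 p q)) = 0 := by
    have := (d1 p q).finrank_range_le
    rw [finrank_zero_of_subsingleton (M := A p q)] at this
    omega
  have hs1 : ∑ p ∈ T, finrank K (range (d1 (p - 1) (k - p))) =
      ∑ p ∈ T, finrank K (range (d1 p (k - 1 - p))) := by
    rw [← finsum_eq_sum_of_support_subset, ← finsum_eq_sum_of_support_subset]
    · refine (finsum_congr fun p => ?_).trans (finsum_comp_equiv (Equiv.subRight (1 : ℤ)))
      rw [Equiv.subRight_apply, show k - 1 - (p - 1) = k - p by ring]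
    · exact fun p hp => by_contra fun hpT => hp (hzero _ _ (hT p hpT _))
    · exact fun p hp => by_contra fun hpT => hp (hzero _ _ (hT' p hpT _))
  have hs2 : ∑ p ∈ T, finrank K (range (d2 p (k - p - 1))) =
      ∑ p ∈ T, finrank K (range (d2 p (k - 1 - p))) :=
    Finset.sum_congr rfl fun p _ => by rw [sub_right_comm]
  have hpt := Finset.sum_le_sum fun p (_ : p ∈ T) =>
    two_mul_finrank_le hd1d1 hd2d2 hanti p (k - p)
  simp only [Finset.sum_add_distrib, ← Finset.mul_sum, hs1, hs2] at hpt
  rw [hsum, Finset.sum_add_distrib]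
  have := hr1 k
  have := hr2 k
  have := hr1 (k - 1)
  have := hr2 (k - 1)
  omega

end Paper
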